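/- Let Y be a linear subspace of an n-dimensional polyhedral real Banach space X such that Sm(X) ∩ Y is dense in Y. Then Y is an anti-coproximinal subspace of X if and only if 𝒥_Y contains n linearly independent elements. -/

import Mathlib

open Metric Set

variable {X : Type*} [NormedAddCommGroup X] [NormedSpace ℝ X]

/-- `J(x)`: the set of norm-one support functionals of `x`. -/
def normingSet (x : X) : Set (X →L[ℝ] ℝ) := {f | ‖f‖ = 1 ∧ f x = ‖x‖}

/-- `y₀` is a best coapproximation to `x` out of `Y`. -/
def IsBestCoapprox (Y : Submodule ℝ X) (x y₀ : X) : Prop :=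
  ∀ y ∈ Y, ‖y₀ - y‖ ≤ ‖x - y‖

/-- `Y` is an anti-coproximinal subspace of `X`. -/
def AntiCoproximinal (Y : Submodule ℝ X) : Prop :=
  ∀ x ∉ Y, ¬ ∃ y₀ ∈ Y, IsBestCoapprox Y x y₀

/-- Approximate Birkhoff-James orthogonality: `u ⊥_B^ε v`. -/
def ApproxBJOrth (ε : ℝ) (u v : X) : Prop :=
  ∀ t : ℝ, ‖u + t • v‖ ≥ ‖u‖ - ε * ‖t • v‖

/-- `y₀` is an `ε`-best coapproximation to `x` out of `Y`. -/
def IsEpsBestCoapprox (Y : Submodule ℝ X) (ε : ℝ) (x y₀ : X) : Prop :=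
  ∀ y ∈ Y, ApproxBJOrth ε y (x - y₀)

/-- `Y` is a strongly anti-coproximinal subspace of `X`. -/
def StronglyAntiCoproximinal (Y : Submodule ℝ X) : Prop :=
  ∀ x ∉ Y, ∀ ε : ℝ, 0 ≤ ε → ε < 1 → ¬ ∃ y₀ ∈ Y, IsEpsBestCoapprox Y ε x y₀

/-- `x` is a smooth point: nonzero and `J(x)` is a singleton. -/
def SmoothPt (x : X) : Prop := x ≠ 0 ∧ ∃ f, normingSet x = {f}

/-- A smooth Banach space: every nonzero point is a smooth point. -/
def SmoothSpace (X : Type*) [NormedAddCommGroup X] [NormedSpace ℝ X] : Prop :=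
  ∀ x : X, x ≠ 0 → SmoothPt x

/-- `𝒥_Y`: norm-one functionals supporting some norm-one smooth point of `Y`. -/
def JsetY (Y : Submodule ℝ X) : Set (X →L[ℝ] ℝ) :=
  {f | ‖f‖ = 1 ∧ ∃ y ∈ Y, SmoothPt y ∧ ‖y‖ = 1 ∧ f y = 1}

/-- The Kadets-Klee property. -/
def KadetsKlee (Z : Type*) [NormedAddCommGroup Z] [NormedSpace ℝ Z] : Prop :=
  ∀ (z : ℕ → Z) (z₀ : Z),
    (∀ f : Z →L[ℝ] ℝ, Filter.Tendsto (fun k => f (z k)) Filter.atTop (nhds (f z₀))) →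
    Filter.Tendsto (fun k => ‖z k‖) Filter.atTop (nhds ‖z₀‖) →
    Filter.Tendsto z Filter.atTop (nhds z₀)

theorem aux_james [FiniteDimensional ℝ X] (y z : X) (hy : y ≠ 0)
    (h : ∀ t : ℝ, ‖y‖ ≤ ‖y + t • z‖) : ∃ g ∈ normingSet y, g z = 0 := by
  set S : Submodule ℝ X := Submodule.span ℝ {z} with hS
  haveI : IsClosed (S : Set X) := Submodule.closed_of_finiteDimensional S
  have hnorm : ‖(S.mkQ y : X ⧸ S)‖ = ‖y‖ := by
    apply le_antisymm
    · exact Submodule.Quotient.norm_mk_le S y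
    · refine le_of_forall_pos_le_add fun ε hε => ?_
      obtain ⟨m, hm, hlt⟩ := QuotientAddGroup.exists_norm_mk_lt (S := S.toAddSubgroup) (S.mkQ y : X ⧸ S) hε
      have hm2 : (Submodule.Quotient.mk m : X ⧸ S) = Submodule.Quotient.mk y := hm
      rw [Submodule.Quotient.eq, hS, Submodule.mem_span_singleton] at hm2
      obtain ⟨a, ha⟩ := hm2
      have := h a
      rw [ha] at this
      simp only [add_sub_cancel] at this
      exact this.trans hlt.le
  have hne : (S.mkQ y : X ⧸ S) ≠ 0 := by
    intro h0
    rw [h0, norm_zero] at hnorm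
    exact hy (norm_eq_zero.1 hnorm.symm)
  obtain ⟨g, hg1, hg2⟩ := exists_dual_vector ℝ (S.mkQ y : X ⧸ S) (by simpa using hne)
  let G : X →ₗ[ℝ] ℝ := (g : (X ⧸ S) →ₗ[ℝ] ℝ).comp S.mkQ
  have hG : ∀ x, ‖G x‖ ≤ 1 * ‖x‖ := by
    intro x
    calc ‖G x‖ ≤ ‖g‖ * ‖(S.mkQ x : X ⧸ S)‖ := g.le_opNorm _
      _ ≤ 1 * ‖x‖ := by
        rw [hg1]
        gcongr
        exact Submodule.Quotient.norm_mk_le S x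
  have hGy : G y = ‖y‖ := by
    have : G y = g (S.mkQ y) := rfl
    rw [this, hg2, hnorm]; rfl
  refine ⟨G.mkContinuous 1 hG, ⟨?_, ?_⟩, ?_⟩
  · apply le_antisymm (LinearMap.mkContinuous_norm_le _ zero_le_one _)
    have := (G.mkContinuous 1 hG).le_opNorm y
    rw [LinearMap.mkContinuous_apply, hGy, norm_norm] at this
    have hp : 0 < ‖y‖ := norm_pos_iff.2 hy
    by_contra hlt
    push Not at hlt
    nlinarith
  · simpa using hGy
  · have : (S.mkQ z : X ⧸ S) = 0 := by
      simp [hS, Submodule.mem_span_singleton_self]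
    change g (S.mkQ z) = 0
    rw [this, map_zero]

theorem aux_smul (y : X) (hy : y ≠ 0) : normingSet (‖y‖⁻¹ • y) = normingSet y := by
  have hp : ‖y‖ ≠ 0 := norm_ne_zero_iff.2 hy
  ext f
  simp only [normingSet, mem_setOf_eq, map_smul, smul_eq_mul, norm_smul, norm_inv, norm_norm]
  refine and_congr_right fun _ => ⟨fun h => ?_, fun h => by rw [h]⟩
  exact mul_left_cancel₀ (inv_ne_zero hp) h

theorem aux_exists [FiniteDimensional ℝ X] (S : Set (X →L[ℝ] ℝ))
    (hS : Submodule.span ℝ S ≠ ⊤) : ∃ z : X, z ≠ 0 ∧ ∀ f ∈ S, f z = 0 := by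
  obtain ⟨φ, hφ, hle⟩ := Submodule.exists_le_ker_of_lt_top _ (lt_top_iff_ne_top.2 hS)
  let e : Module.Dual ℝ X ≃ₗ[ℝ] (X →L[ℝ] ℝ) := LinearMap.toContinuousLinearMap
  obtain ⟨z, hz⟩ := (Module.evalEquiv ℝ X).surjective (φ.comp e.toLinearMap)
  have key : ∀ f : X →L[ℝ] ℝ, φ f = f z := by
    intro f
    have := LinearMap.congr_fun hz (f : X →ₗ[ℝ] ℝ)
    simp only [Module.evalEquiv_apply] at this
    exact this.symm
  refine ⟨z, ?_, fun f hf => ?_⟩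
  · rintro rfl
    apply hφ
    ext f
    simp [key]
  · rw [← key]
    exact hle (Submodule.subset_span hf)

theorem aux_finrank [FiniteDimensional ℝ X] :
    Module.finrank ℝ (X →L[ℝ] ℝ) = Module.finrank ℝ X := by
  rw [← (LinearMap.toContinuousLinearMap : Module.Dual ℝ X ≃ₗ[ℝ] (X →L[ℝ] ℝ)).finrank_eq]
  exact Subspace.dual_finrank_eq

theorem antiCoproximinal_iff_linearIndependent_of_polyhedral [FiniteDimensional ℝ X]
    (n : ℕ) (hn : Module.finrank ℝ X = n)
    (hpoly : (Set.extremePoints ℝ (Metric.closedBall (0 : X) 1)).Finite)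
    (Y : Submodule ℝ X)
    (hdense : (Y : Set X) ⊆ closure ({x : X | SmoothPt x} ∩ (Y : Set X))) :
    AntiCoproximinal Y ↔
      ∃ f : Fin n → (X →L[ℝ] ℝ), (∀ i, f i ∈ JsetY Y) ∧ LinearIndependent ℝ f := by
  haveI : FiniteDimensional ℝ (X →L[ℝ] ℝ) :=
    (LinearMap.toContinuousLinearMap : Module.Dual ℝ X ≃ₗ[ℝ] (X →L[ℝ] ℝ)).finiteDimensional
  constructor
  · intro hA
    have hspan : Submodule.span ℝ (JsetY Y) = ⊤ := by
      by_contra hne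
      obtain ⟨z, hz0, hz⟩ := aux_exists _ hne
      have h1 : ∀ y ∈ Y, ‖y‖ ≤ ‖z - y‖ ∧ ‖y‖ ≤ ‖y - z‖ := by
        intro y hy
        have hcl : IsClosed {y : X | ‖y‖ ≤ ‖y - z‖} :=
          isClosed_le (by fun_prop) (by fun_prop)
        have hsub : ({x : X | SmoothPt x} ∩ (Y : Set X)) ⊆ {y : X | ‖y‖ ≤ ‖y - z‖} := by
          rintro w ⟨⟨hw0, f, hf⟩, hwY⟩
          have hfm : f ∈ normingSet w := by rw [hf]; rfl
          have hp : ‖w‖ ≠ 0 := norm_ne_zero_iff.2 hw0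
          have hfJ : f ∈ JsetY Y := by
            refine ⟨hfm.1, ‖w‖⁻¹ • w, Y.smul_mem _ hwY, ⟨?_, f, ?_⟩, ?_, ?_⟩
            · exact smul_ne_zero (inv_ne_zero hp) hw0
            · rw [aux_smul w hw0, hf]
            · rw [norm_smul, norm_inv, norm_norm, inv_mul_cancel₀ hp]
            · rw [map_smul, hfm.2, smul_eq_mul, inv_mul_cancel₀ hp]
          have h2 := (le_abs_self _).trans (f.le_opNorm (w - z))
          rw [map_sub, hz f hfJ, hfm.1, hfm.2] at h2
          simpa using h2
        have := closure_minimal hsub hcl (hdense hy)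
        exact ⟨by rw [norm_sub_rev]; exact this, this⟩
      have hzY : z ∉ Y := by
        intro hzY
        have := (h1 z hzY).1
        rw [sub_self, norm_zero] at this
        exact hz0 (norm_le_zero_iff.1 this)
      refine hA z hzY ⟨0, Y.zero_mem, fun y hy => ?_⟩
      simpa using (h1 y hy).1
    obtain ⟨f, hf, -, hli⟩ := Submodule.exists_fun_fin_finrank_span_eq ℝ (JsetY Y)
    have hd : Module.finrank ℝ (Submodule.span ℝ (JsetY Y)) = n := by
      rw [hspan, finrank_top, aux_finrank, hn]
    subst hd
    exact ⟨f, hf, hli⟩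
  · rintro ⟨f, hf, hli⟩ x hx ⟨y₀, hy₀, hb⟩
    have hspan : Submodule.span ℝ (range f) = ⊤ :=
      hli.span_eq_top_of_card_eq_finrank' (by rw [aux_finrank, hn, Fintype.card_fin])
    have horth : ∀ w ∈ Y, ∀ t : ℝ, ‖w‖ ≤ ‖w + t • (x - y₀)‖ := by
      intro w hw t
      by_cases ht : t = 0
      · simp [ht]
      have h := hb (y₀ - t⁻¹ • w) (Y.sub_mem hy₀ (Y.smul_mem _ hw))
      have e1 : w = t • (y₀ - (y₀ - t⁻¹ • w)) := by
        rw [sub_sub_cancel, smul_inv_smul₀ ht]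
      have e2 : w + t • (x - y₀) = t • (x - (y₀ - t⁻¹ • w)) := by
        rw [smul_sub, smul_sub, smul_sub, smul_inv_smul₀ ht]; abel
      rw [e2]
      nth_rewrite 1 [e1]
      rw [norm_smul, norm_smul]
      gcongr
    have hzero : ∀ i, f i (x - y₀) = 0 := by
      intro i
      obtain ⟨hn1, y, hyY, ⟨hy0, g, hg⟩, hy1, hfy⟩ := hf i
      obtain ⟨k, hk, hkz⟩ := aux_james y (x - y₀) hy0 (horth y hyY)
      have hfi : f i ∈ normingSet y := ⟨hn1, by rw [hfy, hy1]⟩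
      rw [hg, mem_singleton_iff] at hk hfi
      rw [hfi, ← hk, hkz]
    have hall : ∀ g : X →L[ℝ] ℝ, g (x - y₀) = 0 := by
      intro g
      have hg : g ∈ Submodule.span ℝ (range f) := by rw [hspan]; trivial
      induction hg using Submodule.span_induction with
      | mem g h => obtain ⟨i, rfl⟩ := h; exact hzero i
      | zero => rfl
      | add a b _ _ ha hb => simp only [ContinuousLinearMap.add_apply, ha, hb, add_zero]
      | smul c a _ ha => simp only [ContinuousLinearMap.smul_apply, ha, smul_zero]
    have : x - y₀ = 0 := by
      by_contra hne
      obtain ⟨g, -, hg⟩ := exists_dual_vector ℝ (x - y₀) (by simpa using hne)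
      rw [hall g] at hg
      exact hne (norm_eq_zero.1 (by simpa using hg.symm))
    rw [sub_eq_zero] at this
    exact hx (this ▸ hy₀)
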